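/- Let k be a field of characteristic 0 and let n ≥ 0 be a natural number. For the trivial one-dimensional representation k of the free abelian group ℤ^{n}, the group cohomology H^i(ℤ^{n}, k) has k-dimension equal to the binomial coefficient C(n, i) for every i ≥ 0 (in particular it vanishes for i > n). -/

import Mathlib

open CategoryTheory

namespace ZnCoh
variable {k G : Type} [Field k] [CommGroup G]

lemma isZero_coind_bot (A : Rep k (⊥ : Subgroup G)) (n : ℕ) :
    Limits.IsZero (groupCohomology (Rep.coind (⊥ : Subgroup G).subtype A) (n+1)) :=
  (isZero_groupCohomology_succ_of_subsingleton A n).of_iso (groupCohomology.coindIso A (n+1))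

/-- unit -/
noncomputable def unit (A : Rep k G) :
    A ⟶ Rep.coind (⊥ : Subgroup G).subtype (Rep.res (⊥ : Subgroup G).subtype A) :=
  Rep.resCoindToHom _ _ _ (𝟙 _)

instance (A : Rep k G) : Mono (unit A) := by
  rw [Rep.mono_iff_injective]
  intro x y h
  have := congrFun (congrArg Subtype.val h) 1
  simpa [unit] using this

lemma map_applyAsHom (t : G) (n : ℕ) : ∀ (A : Rep k G),
    groupCohomology.map (MonoidHom.id G) (A.applyAsHom t) n = 𝟙 _ := by
  induction n with
  | zero =>
    intro A
    have h := groupCohomology.map_id_comp_H0Iso_hom (A.applyAsHom t)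
    have h2 : (Rep.invariantsFunctor k G).map (A.applyAsHom t) = 𝟙 _ := by
      ext x
      exact Subtype.ext (x.2 t)
    rw [h2] at h
    rw [← cancel_mono (groupCohomology.H0Iso A).hom, h]
    exact (Category.comp_id _).trans (Category.id_comp _).symm
  | succ n ih =>
    intro A
    let X : ShortComplex (Rep k G) := ShortComplex.mk (unit A) (Limits.cokernel.π (unit A)) (by simp)
    have hX : X.ShortExact := { exact := ShortComplex.exact_cokernel _, mono_f := by dsimp [X]; infer_instance, epi_g := by dsimp [X]; infer_instance }
    let F : X ⟶ X :=
      { τ₁ := X.X₁.applyAsHom t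
        τ₂ := X.X₂.applyAsHom t
        τ₃ := X.X₃.applyAsHom t
        comm₁₂ := Rep.applyAsHom_comm _ _
        comm₂₃ := Rep.applyAsHom_comm _ _ }
    have := groupCohomology.epi_δ_of_isZero hX n (isZero_coind_bot _ n)
    have h := groupCohomology.δ_naturality hX hX F n (n+1) rfl
    rw [← cancel_epi (groupCohomology.δ hX n (n+1) rfl)]
    refine h.trans ?_
    have h3 : groupCohomology.map (MonoidHom.id G) F.τ₃ n = 𝟙 _ := ih X.X₃
    rw [h3]
    exact (Category.id_comp _).trans (Category.comp_id _).symm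

lemma map_applyAsHom_sub (t : G) (n : ℕ) (A : Rep k G) :
    groupCohomology.map (MonoidHom.id G) (A.applyAsHom t - 𝟙 A) n = 0 := by
  have h : groupCohomology.cochainsMap (MonoidHom.id G) (A.applyAsHom t - 𝟙 A)
      = groupCohomology.cochainsMap (MonoidHom.id G) (A.applyAsHom t) - 𝟙 _ := rfl
  have h2 := map_applyAsHom t n A
  unfold groupCohomology.map at h2 ⊢
  rw [h, HomologicalComplex.homologyMap_sub, h2, HomologicalComplex.homologyMap_id]
  exact sub_self _

lemma exists_antidiff (φ : ℤ → k) : ∃ Φ : ℤ → k, ∀ m, Φ (m+1) - Φ m = φ m := by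
  refine ⟨fun m => ∑ j ∈ Finset.range m.toNat, φ j
    - ∑ j ∈ Finset.range (-m).toNat, φ (-(j+1)), fun m => ?_⟩
  rcases m with m | m
  · have h1 : (Int.ofNat m + 1).toNat = m + 1 := by simp
    have h2 : (-(Int.ofNat m + 1)).toNat = 0 := by simp
    have h3 : (Int.ofNat m).toNat = m := by simp
    have h4 : (-(Int.ofNat m)).toNat = 0 := by simp
    simp only [h1,h2,h3,h4, Finset.sum_range_succ]
    simp
  · have h1 : (Int.negSucc m + 1).toNat = 0 := by omega
    have h2 : (-(Int.negSucc m + 1)).toNat = m := by omega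
    have h3 : (Int.negSucc m).toNat = 0 := by omega
    have h4 : (-(Int.negSucc m)).toNat = m+1 := by omega
    simp only [h1,h2,h3,h4, Finset.sum_range_succ]
    have : (Int.negSucc m) = -((m:ℤ)+1) := by omega
    simp [this]

section
variable (χ : G →* Multiplicative ℤ) (t : G)

variable (k) in
/-- functions on the quotient by the kernel of `χ` -/
noncomputable abbrev C : Rep k G := Rep.coind χ.ker.subtype (Rep.trivial k χ.ker k)

variable (k) in
/-- constants -/
noncomputable def cst : Rep.trivial k G k ⟶ C k χ :=
  Rep.resCoindToHom χ.ker.subtype (Rep.trivial k G k) (Rep.trivial k χ.ker k)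
    (Rep.ofHom ⟨LinearMap.id, fun g => by rfl⟩)

variable (k) in
lemma cst_apply (c : k) (g : G) : ((cst k χ).hom c).1 g = c := rfl

lemma app_apply (f : C k χ) (g : G) :
    (((C k χ).applyAsHom t - 𝟙 (C k χ)).hom f).1 g = f.1 (g * t) - f.1 g := rfl

lemma eq_zpow (ht : χ t = Multiplicative.ofAdd 1) (f : C k χ) (g : G) : f.1 g = f.1 (t ^ (χ g).toAdd) := by
  have hs : g * (t ^ (χ g).toAdd)⁻¹ ∈ χ.ker := by
    rw [MonoidHom.mem_ker, map_mul, map_inv, map_zpow, ht, ← ofAdd_zsmul]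
    simp
  have := f.2 ⟨_, hs⟩ (t ^ (χ g).toAdd)
  simpa using this

variable (k) in
/-- The short complex. -/
noncomputable def X : ShortComplex (Rep k G) :=
  ShortComplex.mk (cst k χ) ((C k χ).applyAsHom t - 𝟙 (C k χ)) (by
    ext g
    exact sub_self (1 : k))

lemma X_shortExact (ht : χ t = Multiplicative.ofAdd 1) : (X k χ t).ShortExact where
  exact := by
    refine (ShortComplex.exact_map_iff_of_faithful _ (forget₂ (Rep k G) (ModuleCat k))).1 ?_
    rw [ShortComplex.moduleCat_exact_iff]
    intro (f : C k χ) hf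
    have hf' : ∀ g, f.1 (g * t) = f.1 g := fun g => by
      have := congrFun (congrArg Subtype.val hf) g
      exact sub_eq_zero.1 ((app_apply χ t f g).symm.trans this)
    refine ⟨f.1 1, ?_⟩
    apply Subtype.ext
    funext g
    change f.1 1 = f.1 g
    rw [eq_zpow χ t ht f g]
    generalize (χ g).toAdd = m
    induction m with
    | zero => simp
    | succ m ih => rw [zpow_add_one, hf', ih]
    | pred m ih => rw [ih, ← hf' (t ^ (-(m : ℤ) - 1)), ← zpow_add_one]; simp
  mono_f := by
    rw [Rep.mono_iff_injective]
    intro x y h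
    exact congrFun (congrArg Subtype.val h) 1
  epi_g := by
    rw [Rep.epi_iff_surjective]
    intro (f : C k χ)
    obtain ⟨Φ, hΦ⟩ := exists_antidiff (fun m => f.1 (t ^ m))
    refine ⟨⟨fun g => Φ (χ g).toAdd, ?_⟩, ?_⟩
    · intro s g
      have : χ s = 1 := s.2
      simp [this]
    · apply Subtype.ext
      funext g
      refine (app_apply χ t _ g).trans ?_
      rw [eq_zpow χ t ht f g, ← hΦ]
      simp [ht]

lemma rank_succ (ht : χ t = Multiplicative.ofAdd 1) (i : ℕ) :
    Module.rank k (groupCohomology (Rep.trivial k G k) (i+1)) =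
    Module.rank k (groupCohomology (Rep.trivial k χ.ker k) (i+1)) +
    Module.rank k (groupCohomology (Rep.trivial k χ.ker k) i) := by
  have hX := X_shortExact (k := k) χ t ht
  let f := (groupCohomology.map (A := (X k χ t).X₁) (B := (X k χ t).X₂) (MonoidHom.id G) (X k χ t).f (i+1)).hom
  let d := (groupCohomology.δ hX i (i+1) rfl).hom
  have hf : Function.Surjective f := by
    intro y
    have := (ShortComplex.moduleCat_exact_iff _).1 (groupCohomology.mapShortComplex₂_exact hX (i+1))
    refine this y ?_
    have h0 := map_applyAsHom_sub t (i+1) (C k χ)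
    exact congrArg (fun φ => φ.hom y) h0
  have hd : Function.Injective d := by
    rw [injective_iff_map_eq_zero]
    intro y hy
    have := (ShortComplex.moduleCat_exact_iff _).1 (groupCohomology.mapShortComplex₃_exact hX (i := i) rfl)
    obtain ⟨z, rfl⟩ := this y hy
    have h0 := map_applyAsHom_sub t i (C k χ)
    exact congrArg (fun φ => φ.hom z) h0
  have hfd : LinearMap.range d = LinearMap.ker f :=
    (groupCohomology.mapShortComplex₁_exact hX (i := i) rfl).moduleCat_range_eq_ker
  have e1 := (groupCohomology.coindIso (Rep.trivial k χ.ker k) (i+1)).toLinearEquiv.rank_eq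
  have e2 := (groupCohomology.coindIso (Rep.trivial k χ.ker k) i).toLinearEquiv.rank_eq
  have h1 := LinearMap.rank_range_add_rank_ker f
  rw [rank_range_of_surjective f hf, ← hfd, rank_range_of_injective d hd] at h1
  rw [← e1, ← e2]
  exact h1.symm
end

lemma rank_zero (G : Type) [CommGroup G] :
    Module.rank k (groupCohomology (Rep.trivial k G k) 0) = 1 := by
  rw [(groupCohomology.H0IsoOfIsTrivial (Rep.trivial k G k)).toLinearEquiv.rank_eq]
  exact Module.rank_self k

/-- kernel of first coordinate -/
def kerEquiv (n : ℕ) (G : Type) [CommGroup G] (e : G ≃* Multiplicative (Fin (n+1) → ℤ))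
    (χ : G →* Multiplicative ℤ) (hχ : ∀ g, (χ g).toAdd = (e g).toAdd 0) :
    χ.ker ≃* Multiplicative (Fin n → ℤ) where
  toFun g := Multiplicative.ofAdd (fun i => (e g.1).toAdd i.succ)
  invFun v := ⟨e.symm (Multiplicative.ofAdd (Fin.cons 0 v.toAdd)), by
    rw [MonoidHom.mem_ker]
    apply Multiplicative.toAdd.injective
    rw [hχ]; simp⟩
  left_inv g := by
    apply Subtype.ext
    apply e.injective
    have h := hχ g.1
    rw [MonoidHom.mem_ker.1 g.2] at h
    simp only [MulEquiv.apply_symm_apply]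
    apply Multiplicative.toAdd.injective
    funext i
    refine Fin.cases ?_ (fun i => ?_) i
    · simpa using h
    · simp
  right_inv v := by
    apply Multiplicative.toAdd.injective
    funext i
    simp
  map_mul' a b := by
    apply Multiplicative.toAdd.injective
    funext i
    simp

lemma rank_eq (n : ℕ) : ∀ (G : Type) [CommGroup G] (_ : G ≃* Multiplicative (Fin n → ℤ)) (i : ℕ),
    Module.rank k (groupCohomology (Rep.trivial k G k) i) = (n.choose i : ℕ) := by
  induction n with
  | zero =>
    intro G _ e i
    have : Subsingleton G := e.toEquiv.subsingleton
    cases i with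
    | zero => rw [rank_zero]; simp
    | succ i =>
      have := ModuleCat.subsingleton_of_isZero
        (isZero_groupCohomology_succ_of_subsingleton (Rep.trivial k G k) i)
      rw [rank_subsingleton']; simp
  | succ n ih =>
    intro G _ e i
    cases i with
    | zero => rw [rank_zero]; simp
    | succ i =>
      let χ : G →* Multiplicative ℤ :=
        (AddMonoidHom.toMultiplicative (Pi.evalAddMonoidHom (fun _ : Fin (n+1) => ℤ) 0)).comp
          e.toMonoidHom
      have hχ : ∀ g, (χ g).toAdd = (e g).toAdd 0 := fun g => rfl
      let t : G := e.symm (Multiplicative.ofAdd (fun _ => 1))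
      have ht : χ t = Multiplicative.ofAdd 1 := by
        apply Multiplicative.toAdd.injective
        rw [hχ]; simp [t]
      let e' := kerEquiv n G e χ hχ
      rw [rank_succ χ t ht i, ih _ e', ih _ e', Nat.choose_succ_succ]
      push_cast
      exact add_comm _ _

end ZnCoh

theorem groupCohomology_trivial_finrank_eq_choose
    {k : Type} [Field k] [CharZero k] (n : ℕ) (i : ℕ) :
    Module.finrank k
      (groupCohomology (Rep.trivial k (Multiplicative (Fin n → ℤ)) k) i) = n.choose i := by
  exact Module.finrank_eq_of_rank_eq (ZnCoh.rank_eq n _ (MulEquiv.refl _) i)
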